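/- If a, b, c are two-free base-3/2 digit strings satisfying v(a) + v(c) = 2 · v(b), then a = b = c; that is, no three distinct values of two-free base-3/2 digit strings form a three-term arithmetic progression. -/

import Mathlib

/-- The value of a base-3/2 digit string. -/
def val32 (d : ℕ →₀ ℕ) : ℚ := d.sum fun i c => (c : ℚ) * (3 / 2 : ℚ) ^ i

/-- A digit string is two-free if all of its digits are 0 or 1. -/
def TwoFree (d : ℕ →₀ ℕ) : Prop := ∀ i, d i ≤ 1

/-- If a homogeneous combination of powers of `3` and `2` with coefficients of absolute value
at most `2` vanishes, then so do its coefficients. -/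
theorem eq_zero_of_sum_three_pow_mul_two_pow_eq_zero (n : ℕ) (e : ℕ → ℤ) (he : ∀ i, |e i| ≤ 2)
    (h : ∑ i ∈ Finset.range n, e i * 3 ^ i * 2 ^ (n - i) = 0) : ∀ i < n, e i = 0 := by
  induction n generalizing e with
  | zero => simp
  | succ n ih =>
    have hshift : ∑ i ∈ Finset.range n, e (i + 1) * 3 ^ (i + 1) * 2 ^ (n + 1 - (i + 1))
        = 3 * ∑ i ∈ Finset.range n, e (i + 1) * 3 ^ i * 2 ^ (n - i) := by
      rw [Finset.mul_sum]
      refine Finset.sum_congr rfl fun i _ => ?_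
      rw [Nat.add_sub_add_right]
      ring
    rw [Finset.sum_range_succ', hshift] at h
    simp only [pow_zero, mul_one, Nat.sub_zero] at h
    have hdvd : (3 : ℤ) ∣ e 0 * 2 ^ (n + 1) :=
      (dvd_add_right (dvd_mul_right 3 _)).mp (h ▸ dvd_zero 3)
    have hcop : IsCoprime (3 : ℤ) (2 ^ (n + 1)) := IsCoprime.pow_right ⟨1, -1, by norm_num⟩
    have hdvd0 : (3 : ℤ) ∣ e 0 := hcop.dvd_of_dvd_mul_right hdvd
    have h0 : e 0 = 0 := by
      have := abs_le.mp (he 0)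
      omega
    rw [h0, zero_mul, add_zero] at h
    have htail := ih (fun i => e (i + 1)) (fun i => he (i + 1))
      ((mul_eq_zero.mp h).resolve_left (by norm_num))
    rintro (_ | i) hi
    · exact h0
    · exact htail i (by omega)

theorem val32_eq_sum_range {d : ℕ →₀ ℕ} {n : ℕ} (hd : d.support ⊆ Finset.range n) :
    val32 d = ∑ i ∈ Finset.range n, (d i : ℚ) * (3 / 2) ^ i :=
  Finsupp.sum_of_support_subset d hd _ (by simp)

/-- No three distinct values of two-free base-3/2 digit strings form a
three-term arithmetic progression. -/
theorem twoFree_no_three_term_AP (a b c : ℕ →₀ ℕ)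
    (ha : TwoFree a) (hb : TwoFree b) (hc : TwoFree c)
    (h : val32 a + val32 c = 2 * val32 b) :
    a = b ∧ b = c := by
  obtain ⟨n, hn⟩ := (a.support ∪ b.support ∪ c.support).exists_nat_subset_range
  have hna : a.support ⊆ Finset.range n := fun i hi => hn (by simp_all)
  have hnb : b.support ⊆ Finset.range n := fun i hi => hn (by simp_all)
  have hnc : c.support ⊆ Finset.range n := fun i hi => hn (by simp_all)
  rw [val32_eq_sum_range hna, val32_eq_sum_range hnb, val32_eq_sum_range hnc] at h
  have hsum : ∑ i ∈ Finset.range n, ((a i : ℤ) + c i - 2 * b i) * 3 ^ i * 2 ^ (n - i) = 0 := by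
    have hcast : ((∑ i ∈ Finset.range n,
        ((a i : ℤ) + c i - 2 * b i) * 3 ^ i * 2 ^ (n - i) : ℤ) : ℚ)
        = 2 ^ n * (∑ i ∈ Finset.range n, (a i : ℚ) * (3 / 2) ^ i
          + ∑ i ∈ Finset.range n, (c i : ℚ) * (3 / 2) ^ i
          - 2 * ∑ i ∈ Finset.range n, (b i : ℚ) * (3 / 2) ^ i) := by
      rw [Finset.mul_sum, ← Finset.sum_add_distrib, ← Finset.sum_sub_distrib, Finset.mul_sum]
      push_cast
      refine Finset.sum_congr rfl fun i hi => ?_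
      rw [pow_sub₀ (2 : ℚ) two_ne_zero (Finset.mem_range.mp hi).le, div_pow]
      ring
    rw [h, sub_self, mul_zero] at hcast
    exact_mod_cast hcast
  have hzero := eq_zero_of_sum_three_pow_mul_two_pow_eq_zero n _ (fun i => by
    have := ha i
    have := hb i
    have := hc i
    rw [abs_le]
    omega) hsum
  have hdigit : ∀ i, a i = b i ∧ b i = c i := fun i => by
    by_cases hi : i < n
    · have := hzero i hi
      have := ha i
      have := hb i
      have := hc i
      omega
    · have hout : ∀ d : ℕ →₀ ℕ, d.support ⊆ Finset.range n → d i = 0 := fun d hd =>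
        Finsupp.notMem_support_iff.mp fun hmem => hi (Finset.mem_range.mp (hd hmem))
      simp [hout a hna, hout b hnb, hout c hnc]
  exact ⟨Finsupp.ext fun i => (hdigit i).1, Finsupp.ext fun i => (hdigit i).2⟩
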